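/- There exists a Latin square of order 8 possessing a critical set of size exactly 16. -/

import Mathlib

/-- A Latin square of order `n`, represented as a function giving the entry in
row `i`, column `j`: every element occurs exactly once in each row and column. -/
def IsLatinSquare {n : ℕ} (L : Fin n → Fin n → Fin n) : Prop :=
  (∀ i, Function.Injective (L i)) ∧ (∀ j, Function.Injective fun i => L i j)

/-- The set of triples `(i, j; L i j)` of a square `L`. -/
def entries {n : ℕ} (L : Fin n → Fin n → Fin n) : Finset (Fin n × Fin n × Fin n) :=
  Finset.univ.image fun p : Fin n × Fin n => (p.1, p.2, L p.1 p.2)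

/-- `T` is a Latin trade in `L`: the (nonempty) set of entries of `L` in the positions
where `L` differs from some other Latin square `L'` of the same order. -/
def IsTrade {n : ℕ} (L : Fin n → Fin n → Fin n)
    (T : Finset (Fin n × Fin n × Fin n)) : Prop :=
  ∃ L' : Fin n → Fin n → Fin n, IsLatinSquare L' ∧ L' ≠ L ∧
    T = (Finset.univ.filter fun p : Fin n × Fin n => L p.1 p.2 ≠ L' p.1 p.2).image
          fun p => (p.1, p.2, L p.1 p.2)

/-- `U` is a uniquely completable set for `L`: `U ⊆ L` and `L` is the only
Latin square of order `n` containing `U`. -/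
def IsUC {n : ℕ} (L : Fin n → Fin n → Fin n)
    (U : Finset (Fin n × Fin n × Fin n)) : Prop :=
  U ⊆ entries L ∧
    ∀ L' : Fin n → Fin n → Fin n, IsLatinSquare L' → U ⊆ entries L' → L' = L

/-- `C` is a critical set of `L`: a uniquely completable set for `L`,
no proper subset of which is uniquely completable. -/
def IsCritical {n : ℕ} (L : Fin n → Fin n → Fin n)
    (C : Finset (Fin n × Fin n × Fin n)) : Prop :=
  IsUC L C ∧ ∀ C' ⊂ C, ¬ IsUC L C'

/-- `scs n`: the smallest size of a critical set in any Latin square of order `n`. -/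
noncomputable def scs (n : ℕ) : ℕ :=
  sInf {s | ∃ (L : Fin n → Fin n → Fin n) (C : Finset (Fin n × Fin n × Fin n)),
    IsLatinSquare L ∧ IsCritical L C ∧ C.card = s}

/-- `R(T)`: the number of distinct rows occurring in `T`. -/
def rowCount {n : ℕ} (T : Finset (Fin n × Fin n × Fin n)) : ℕ :=
  (T.image fun t => t.1).card

/-- `C(T)`: the number of distinct columns occurring in `T`. -/
def colCount {n : ℕ} (T : Finset (Fin n × Fin n × Fin n)) : ℕ :=
  (T.image fun t => t.2.1).card

/-- `E(T)`: the number of distinct elements occurring in `T`. -/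
def elemCount {n : ℕ} (T : Finset (Fin n × Fin n × Fin n)) : ℕ :=
  (T.image fun t => t.2.2).card

/-- A cell is forced by the known cells `A` of `L` if every other column of its row is either
known in that row or already contains the element of the cell. -/
def IsForced {n : ℕ} (L : Fin n → Fin n → Fin n) (A : List (Fin n × Fin n))
    (p : Fin n × Fin n) : Prop :=
  ∀ j, j ≠ p.2 → (p.1, j) ∈ A ∨ ∃ i, (i, j) ∈ A ∧ L i j = L p.1 p.2

instance {n : ℕ} (L : Fin n → Fin n → Fin n) (A : List (Fin n × Fin n))
    (p : Fin n × Fin n) : Decidable (IsForced L A p) := by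
  unfold IsForced; infer_instance

/-- Each cell of the list is forced by `A` together with the cells preceding it in the list. -/
def IsForcingSequence {n : ℕ} (L : Fin n → Fin n → Fin n) :
    List (Fin n × Fin n) → List (Fin n × Fin n) → Prop
  | _, [] => True
  | A, p :: ps => IsForced L A p ∧ IsForcingSequence L (p :: A) ps

instance decidableIsForcingSequence {n : ℕ} (L : Fin n → Fin n → Fin n) :
    ∀ A ps, Decidable (IsForcingSequence L A ps)
  | _, [] => isTrue trivial
  | A, p :: ps =>
    have := decidableIsForcingSequence L (p :: A) ps
    inferInstanceAs (Decidable (IsForced L A p ∧ IsForcingSequence L (p :: A) ps))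

theorem IsForced.eq {n : ℕ} {L L' : Fin n → Fin n → Fin n} (hL : IsLatinSquare L)
    (hL' : IsLatinSquare L') {A : List (Fin n × Fin n)} {p : Fin n × Fin n}
    (hp : IsForced L A p) (hA : ∀ q ∈ A, L' q.1 q.2 = L q.1 q.2) :
    L' p.1 p.2 = L p.1 p.2 := by
  obtain ⟨j, hj⟩ := Finite.surjective_of_injective (hL'.1 p.1) (L p.1 p.2)
  by_cases hne : j = p.2
  · rwa [hne] at hj
  · rcases hp j hne with h | ⟨i, hi, hij⟩
    · exact absurd (hL.1 p.1 ((hA _ h).symm.trans hj)) hne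
    · have hrow : i = p.1 := hL'.2 j (((hA _ hi).trans hij).trans hj.symm)
      rw [hrow] at hij
      exact absurd (hL.1 p.1 hij) hne

theorem IsForcingSequence.eq {n : ℕ} {L L' : Fin n → Fin n → Fin n} (hL : IsLatinSquare L)
    (hL' : IsLatinSquare L') {A ps : List (Fin n × Fin n)} (hps : IsForcingSequence L A ps)
    (hA : ∀ q ∈ A, L' q.1 q.2 = L q.1 q.2) : ∀ q ∈ ps, L' q.1 q.2 = L q.1 q.2 := by
  induction ps generalizing A with
  | nil => simp
  | cons p ps ih =>
    have hp := hps.1.eq hL hL' hA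
    exact List.forall_mem_cons.2 ⟨hp, ih hps.2 (List.forall_mem_cons.2 ⟨hp, hA⟩)⟩

theorem mem_entries {n : ℕ} {L : Fin n → Fin n → Fin n} {t : Fin n × Fin n × Fin n} :
    t ∈ entries L ↔ L t.1 t.2.1 = t.2.2 := by
  obtain ⟨i, j, k⟩ := t
  simp [entries]

/-- The back circulant Latin square of order 8. -/
def backCirculant (i j : Fin 8) : Fin 8 := i + j

theorem isLatinSquare_backCirculant : IsLatinSquare backCirculant :=
  ⟨fun i => add_right_injective i, fun j => add_left_injective j⟩

/-- The cells of two opposite triangular corners of an array of order 8. -/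
def cornerCells : List (Fin 8 × Fin 8) :=
  (List.finRange 8 ×ˢ List.finRange 8).filter
    fun p => p.1.val + p.2.val ≤ 3 ∨ 12 ≤ p.1.val + p.2.val

/-- The cells outside the two corners, in an order in which they are successively forced:
the elements `3, 2, 1, 0` from the bottom row up, then `4, 5, 6, 7` from the top row down. -/
def fillingOrder : List (Fin 8 × Fin 8) :=
  (([3, 2, 1, 0] : List (Fin 8)).flatMap fun k =>
    ((List.finRange 8).reverse.filter (k < ·)).map fun i => (i, k - i)) ++
  (([4, 5, 6, 7] : List (Fin 8)).flatMap fun k =>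
    ((List.finRange 8).filter (· ≤ k)).map fun i => (i, k - i))

/-- The entries of the back circulant square in the two corners. -/
def cornerEntries : Finset (Fin 8 × Fin 8 × Fin 8) :=
  (cornerCells.map fun p => (p.1, p.2, backCirculant p.1 p.2)).toFinset

theorem mem_cornerEntries {t : Fin 8 × Fin 8 × Fin 8} :
    t ∈ cornerEntries ↔
      (t.1, t.2.1) ∈ cornerCells ∧ backCirculant t.1 t.2.1 = t.2.2 := by
  obtain ⟨i, j, k⟩ := t
  simp [cornerEntries]

theorem isUC_cornerEntries : IsUC backCirculant cornerEntries := by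
  refine ⟨fun t ht => mem_entries.2 (mem_cornerEntries.1 ht).2, fun L' hL' hsub => ?_⟩
  have hcorner : ∀ q ∈ cornerCells, L' q.1 q.2 = backCirculant q.1 q.2 := fun q hq =>
    mem_entries.1 (hsub (mem_cornerEntries (t := (q.1, q.2, _)).2 ⟨hq, rfl⟩))
  have hseq : IsForcingSequence backCirculant cornerCells fillingOrder := by decide +kernel
  have hfill := hseq.eq isLatinSquare_backCirculant hL' hcorner
  have hcover : ∀ i j : Fin 8, (i, j) ∈ cornerCells ∨ (i, j) ∈ fillingOrder := by
    decide +kernel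
  funext i j
  exact (hcover i j).elim (hcorner (i, j)) (hfill (i, j))

/-- The back circulant square with the intercalate through the cell `p` switched. -/
def switchedSquare (p : Fin 8 × Fin 8) (i j : Fin 8) : Fin 8 :=
  if (i = p.1 ∨ i = p.1 + 4) ∧ (j = p.2 ∨ j = p.2 + 4) then i + j + 4 else i + j

theorem isLatinSquare_switchedSquare (p : Fin 8 × Fin 8) :
    IsLatinSquare (switchedSquare p) := by
  have h : ∀ a b i j j' : Fin 8,
      switchedSquare (a, b) i j = switchedSquare (a, b) i j' → j = j' := by
    decide +kernel
  have hcomm : ∀ a b i j : Fin 8, switchedSquare (a, b) i j = switchedSquare (b, a) j i := by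
    decide +kernel
  refine ⟨fun i j j' => h p.1 p.2 i j j', fun j i i' hi => h p.2 p.1 j i i' ?_⟩
  rw [hcomm p.2 p.1 j i, hcomm p.2 p.1 j i']
  exact hi

theorem switchedSquare_eq_of_mem_cornerCells :
    ∀ p ∈ cornerCells, ∀ q ∈ cornerCells, q ≠ p →
      switchedSquare p q.1 q.2 = backCirculant q.1 q.2 := by
  decide +kernel

theorem switchedSquare_ne (p : Fin 8 × Fin 8) : switchedSquare p ≠ backCirculant := by
  intro h
  have h' := congrFun (congrFun h p.1) p.2
  simp [switchedSquare, backCirculant] at h'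

theorem isCritical_cornerEntries : IsCritical backCirculant cornerEntries := by
  refine ⟨isUC_cornerEntries, fun C' hC' hUC => ?_⟩
  obtain ⟨hsub, c, hc, hcC'⟩ := Set.ssubset_iff_exists.1 (Finset.coe_ssubset.2 hC')
  obtain ⟨hcell, hval⟩ := mem_cornerEntries.1 hc
  refine switchedSquare_ne (c.1, c.2.1)
    (hUC.2 _ (isLatinSquare_switchedSquare _) fun t ht => mem_entries.2 ?_)
  obtain ⟨htcell, htval⟩ := mem_cornerEntries.1 (hsub ht)
  rw [← htval]
  refine switchedSquare_eq_of_mem_cornerCells _ hcell _ htcell fun heq => hcC' ?_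
  obtain ⟨h₁, h₂⟩ := Prod.mk.inj heq
  have htc : t = c := Prod.ext h₁ (Prod.ext h₂ (by rw [← htval, ← hval, h₁, h₂]))
  exact htc ▸ ht

/-- Some Latin square of order 8 has a critical set of size exactly 16. -/
theorem exists_critical_set_card_sixteen :
    ∃ (L : Fin 8 → Fin 8 → Fin 8) (C : Finset (Fin 8 × Fin 8 × Fin 8)),
      IsLatinSquare L ∧ IsCritical L C ∧ C.card = 16 :=
  ⟨backCirculant, cornerEntries, isLatinSquare_backCirculant, isCritical_cornerEntries,
    by decide +kernel⟩
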